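/- Let F be a number field and K a degree-two extension of F, and let I denote the set of prime ideals 𝔮 of O_F that are inert in K. Define, for Re(s) > 1, U(s) = (s − 1) · ∏_{𝔮 ∈ I} (N𝔮^s + 1)/(N𝔮^s − 1). Then the product converges and U is holomorphic and nonvanishing on Re(s) > 1, and its logarithmic derivative satisfies U'(s)/U(s) = 1/(s − 1) − 2 · ∑_{𝔮 ∈ I} ∑_{m=0}^{∞} (log N𝔮) / N𝔮^{s(2m+1)}, the double sum converging absolutely for Re(s) > 1. -/

import Mathlib

open NumberField

variable (F K : Type*) [Field F] [NumberField F] [Field K] [NumberField K] [Algebra F K]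

/-- The set of prime ideals of `O_F` that are inert in `K`. -/
def InertPrimes : Type _ :=
  {𝔮 : Ideal (𝓞 F) // 𝔮.IsPrime ∧ 𝔮 ≠ ⊥ ∧ (Ideal.map (algebraMap (𝓞 F) (𝓞 K)) 𝔮).IsPrime}

/-- The function `U(s) = (s − 1) · ∏_{𝔮 inert} (N𝔮^s + 1)/(N𝔮^s − 1)`. -/
noncomputable def Ufun (s : ℂ) : ℂ :=
  (s - 1) * ∏' 𝔮 : InertPrimes F K,
    (((Ideal.absNorm 𝔮.1 : ℂ) ^ s + 1) / ((Ideal.absNorm 𝔮.1 : ℂ) ^ s - 1))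

open Filter Topology Ideal nonZeroDivisors in
/-- The Dirichlet series of the Dedekind zeta function, as a sum over ideals, converges
for real exponents greater than one. -/
theorem summable_absNorm_rpow_neg {F : Type*} [Field F] [NumberField F] {σ : ℝ} (hσ : 1 < σ) :
    Summable fun I : Ideal (𝓞 F) => (absNorm I : ℝ) ^ (-σ) := by
  have hL : LSeriesSummable
      (fun n => ((Nat.card {I : Ideal (𝓞 F) // absNorm I = n} : ℝ) : ℂ)) (σ : ℂ) := by
    refine LSeriesSummable_of_sum_norm_bigO_and_nonneg (r := 1) ?_
      (fun _ => Nat.cast_nonneg _) zero_le_one (by simpa using hσ)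
    refine Asymptotics.isBigO_atTop_natCast_rpow_of_tendsto_div_rpow (𝕜 := ℝ) (a := dedekindZeta_residue F) ?_
    rw [dedekindZeta_residue_def]
    refine ((NumberField.Ideal.tendsto_norm_le_div_atTop₀ F).comp
      tendsto_natCast_atTop_atTop).congr fun n => ?_
    simp only [Function.comp_apply, Nat.cast_le, ← Nat.cast_sum, Real.rpow_one]
    congr
    rw [← add_left_inj 1, ← card_norm_le_eq_card_norm_le_add_one,
      show Finset.Icc 1 n = Finset.Ioc 0 n from Finset.Icc_succ_left_eq_Ioc _ _,
      show 1 = Nat.card {I : Ideal (𝓞 F) // absNorm I = 0} by simp [Ideal.absNorm_eq_zero_iff],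
      Finset.sum_Ioc_add_eq_sum_Icc (n.zero_le),
      ← Finset.card_preimage_eq_sum_card_image_eq (fun k _ => finite_setOfPred_absNorm_eq k)]
    simp [Set.coe_eq_subtype]
  rw [← (Equiv.sigmaFiberEquiv (fun I : Ideal (𝓞 F) => absNorm I)).summable_iff,
    summable_sigma_of_nonneg (fun _ => by simp only [Function.comp_apply]; positivity)]
  have hfin (n : ℕ) : Finite {I : Ideal (𝓞 F) // absNorm I = n} := finite_setOfPred_absNorm_eq n
  refine ⟨fun n => Summable.of_finite, hL.norm.congr fun n => ?_⟩
  have hterm (I : {I : Ideal (𝓞 F) // absNorm I = n}) :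
      ((fun I : Ideal (𝓞 F) => (absNorm I : ℝ) ^ (-σ)) ∘
        Equiv.sigmaFiberEquiv (fun I : Ideal (𝓞 F) => absNorm I)) ⟨n, I⟩ = (n : ℝ) ^ (-σ) := by
    simp [Equiv.sigmaFiberEquiv, I.2]
  simp_rw [hterm]
  rw [tsum_const, LSeries.norm_term_eq]
  rcases eq_or_ne n 0 with rfl | hn
  · simp [Real.zero_rpow (by linarith : -σ ≠ 0)]
  · simp [hn, Real.rpow_neg, div_eq_mul_inv]

section EulerFactor

variable {N : ℕ} {s : ℂ}

theorem norm_natCast_cpow_neg_le_half (hN : 2 ≤ N) (hs : 1 < s.re) :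
    ‖(N : ℂ) ^ (-s)‖ ≤ 1 / 2 := by
  rw [Complex.norm_natCast_cpow_of_pos (by omega), Complex.neg_re]
  have hN' : (2 : ℝ) ≤ N := by exact_mod_cast hN
  calc (N : ℝ) ^ (-s.re) ≤ (N : ℝ) ^ (-1 : ℝ) :=
        Real.rpow_le_rpow_of_exponent_le (by linarith) (by linarith)
    _ = (N : ℝ)⁻¹ := Real.rpow_neg_one _
    _ ≤ 1 / 2 := by rw [one_div]; exact inv_anti₀ two_pos hN'

theorem two_le_norm_natCast_cpow (hN : 2 ≤ N) (hs : 1 < s.re) : 2 ≤ ‖(N : ℂ) ^ s‖ := by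
  have h := norm_natCast_cpow_neg_le_half hN hs
  rw [Complex.cpow_neg, norm_inv, one_div] at h
  have hpos : 0 < ‖(N : ℂ) ^ s‖ := norm_pos_iff.mpr (by simp [show N ≠ 0 by omega])
  exact (inv_le_inv₀ hpos two_pos).mp h

theorem natCast_cpow_sub_one_ne_zero (hN : 2 ≤ N) (hs : 1 < s.re) : (N : ℂ) ^ s - 1 ≠ 0 := by
  intro h
  have := two_le_norm_natCast_cpow hN hs
  rw [sub_eq_zero.mp h] at this
  norm_num at this

theorem natCast_cpow_add_one_ne_zero (hN : 2 ≤ N) (hs : 1 < s.re) : (N : ℂ) ^ s + 1 ≠ 0 := by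
  intro h
  have := two_le_norm_natCast_cpow hN hs
  rw [eq_neg_of_add_eq_zero_left h] at this
  norm_num at this

theorem natCast_cpow_add_one_div_sub_one (hN : 2 ≤ N) (hs : 1 < s.re) :
    ((N : ℂ) ^ s + 1) / ((N : ℂ) ^ s - 1) = 1 + 2 / ((N : ℂ) ^ s - 1) := by
  have := natCast_cpow_sub_one_ne_zero hN hs
  field_simp
  ring

theorem norm_two_div_natCast_cpow_sub_one_le (hN : 2 ≤ N) (hs : 1 < s.re) :
    ‖2 / ((N : ℂ) ^ s - 1)‖ ≤ 4 * (N : ℝ) ^ (-s.re) := by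
  have h2 := two_le_norm_natCast_cpow hN hs
  have h3 : ‖(N : ℂ) ^ s‖ / 2 ≤ ‖(N : ℂ) ^ s - 1‖ := by
    have := norm_sub_norm_le ((N : ℂ) ^ s) 1
    rw [norm_one] at this
    linarith
  rw [norm_div, Complex.norm_ofNat]
  calc 2 / ‖(N : ℂ) ^ s - 1‖ ≤ 2 / (‖(N : ℂ) ^ s‖ / 2) := by gcongr
    _ = 4 * (N : ℝ) ^ (-s.re) := by
      rw [Real.rpow_neg (Nat.cast_nonneg _), ← Complex.norm_natCast_cpow_of_pos (by omega)]
      field_simp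
      norm_num

theorem differentiableAt_natCast_cpow (hN : 2 ≤ N) :
    DifferentiableAt ℂ (fun z : ℂ => (N : ℂ) ^ z) s :=
  DifferentiableAt.const_cpow differentiableAt_id (Or.inl (by norm_cast; omega))

theorem differentiableAt_two_div_natCast_cpow_sub_one (hN : 2 ≤ N) (hs : 1 < s.re) :
    DifferentiableAt ℂ (fun z : ℂ => 2 / ((N : ℂ) ^ z - 1)) s :=
  (differentiableAt_const _).div ((differentiableAt_natCast_cpow hN).sub_const 1)
    (natCast_cpow_sub_one_ne_zero hN hs)

theorem differentiableAt_natCast_cpow_add_one_div_sub_one (hN : 2 ≤ N) (hs : 1 < s.re) :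
    DifferentiableAt ℂ (fun z : ℂ => ((N : ℂ) ^ z + 1) / ((N : ℂ) ^ z - 1)) s :=
  ((differentiableAt_natCast_cpow hN).add_const 1).div
    ((differentiableAt_natCast_cpow hN).sub_const 1) (natCast_cpow_sub_one_ne_zero hN hs)

theorem natCast_cpow_add_one_div_sub_one_ne_zero (hN : 2 ≤ N) (hs : 1 < s.re) :
    ((N : ℂ) ^ s + 1) / ((N : ℂ) ^ s - 1) ≠ 0 :=
  div_ne_zero (natCast_cpow_add_one_ne_zero hN hs) (natCast_cpow_sub_one_ne_zero hN hs)

theorem natCast_cpow_odd_multiple (hN : 2 ≤ N) (m : ℕ) :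
    (N : ℂ) ^ (s * (2 * m + 1)) = ((N : ℂ) ^ s) * (((N : ℂ) ^ s) ^ 2) ^ m := by
  have hN0 : (N : ℂ) ≠ 0 := by norm_cast; omega
  rw [← pow_mul, ← pow_succ', ← Complex.cpow_mul_nat]
  push_cast
  rfl

theorem hasSum_log_div_natCast_cpow (hN : 2 ≤ N) (hs : 1 < s.re) :
    HasSum (fun m : ℕ => (Real.log N : ℂ) / (N : ℂ) ^ (s * (2 * m + 1)))
      ((Real.log N : ℂ) * (N : ℂ) ^ s / (((N : ℂ) ^ s) ^ 2 - 1)) := by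
  have h2 := two_le_norm_natCast_cpow hN hs
  have h0 : (N : ℂ) ^ s ≠ 0 := by
    intro h; rw [h] at h2; norm_num at h2
  have hlt : ‖(((N : ℂ) ^ s) ^ 2)⁻¹‖ < 1 := by
    rw [norm_inv, norm_pow]
    exact inv_lt_one_of_one_lt₀ (by nlinarith)
  have hne : ((N : ℂ) ^ s) ^ 2 - 1 ≠ 0 := by
    have h1 := natCast_cpow_sub_one_ne_zero hN hs
    have h2 := natCast_cpow_add_one_ne_zero hN hs
    convert mul_ne_zero h1 h2 using 1
    ring
  have hval : (Real.log N : ℂ) / (N : ℂ) ^ s * (1 - (((N : ℂ) ^ s) ^ 2)⁻¹)⁻¹ =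
      (Real.log N : ℂ) * (N : ℂ) ^ s / (((N : ℂ) ^ s) ^ 2 - 1) := by
    rw [show 1 - (((N : ℂ) ^ s) ^ 2)⁻¹ = (((N : ℂ) ^ s) ^ 2 - 1) / ((N : ℂ) ^ s) ^ 2 by
      field_simp, inv_div]
    field_simp
  rw [← hval]
  refine ((hasSum_geometric_of_norm_lt_one hlt).mul_left
    ((Real.log N : ℂ) / (N : ℂ) ^ s)).congr_fun fun m => ?_
  rw [natCast_cpow_odd_multiple hN, inv_pow, div_mul_eq_div_div,
    div_eq_mul_inv _ ((((N : ℂ) ^ s) ^ 2) ^ m)]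

theorem logDeriv_natCast_cpow_add_one_div_sub_one (hN : 2 ≤ N) (hs : 1 < s.re) :
    logDeriv (fun z : ℂ => ((N : ℂ) ^ z + 1) / ((N : ℂ) ^ z - 1)) s =
      -2 * ((Real.log N : ℂ) * (N : ℂ) ^ s / (((N : ℂ) ^ s) ^ 2 - 1)) := by
  have hN0 : (N : ℂ) ≠ 0 := by norm_cast; omega
  have h1 := natCast_cpow_sub_one_ne_zero hN hs
  have h2 := natCast_cpow_add_one_ne_zero hN hs
  have hd := differentiableAt_natCast_cpow (s := s) hN
  have hderiv : deriv (fun z : ℂ => (N : ℂ) ^ z) s = (N : ℂ) ^ s * Real.log N := by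
    rw [((hasDerivAt_id' s).const_cpow (Or.inl hN0)).deriv, Complex.natCast_log, mul_one]
  rw [logDeriv_div s h2 h1 (hd.add_const 1) (hd.sub_const 1), logDeriv_apply, logDeriv_apply,
    deriv_add_const, deriv_sub_const, hderiv,
    show ((N : ℂ) ^ s) ^ 2 - 1 = ((N : ℂ) ^ s - 1) * ((N : ℂ) ^ s + 1) by ring]
  field_simp
  ring

end EulerFactor

section EulerProduct

variable {ι : Type*} {N : ι → ℕ}

theorem summable_log_mul_rpow_neg
    (hsum : ∀ σ : ℝ, 1 < σ → Summable fun i => (N i : ℝ) ^ (-σ)) {σ : ℝ} (hσ : 1 < σ)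
    (hN : ∀ i, 2 ≤ N i) : Summable fun i => Real.log (N i) * (N i : ℝ) ^ (-σ) := by
  have hε : 0 < (σ - 1) / 2 := by linarith
  refine Summable.of_nonneg_of_le (fun i => ?_) (fun i => ?_)
    ((hsum ((σ + 1) / 2) (by linarith)).mul_left ((σ - 1) / 2)⁻¹)
  · have := Real.log_natCast_nonneg (N i)
    positivity
  · have hpos : (0 : ℝ) < N i := by have := hN i; positivity
    calc Real.log (N i) * (N i : ℝ) ^ (-σ)
        ≤ ((N i : ℝ) ^ ((σ - 1) / 2) / ((σ - 1) / 2)) * (N i : ℝ) ^ (-σ) := by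
          gcongr
          exact Real.log_le_rpow_div hpos.le hε
      _ = ((σ - 1) / 2)⁻¹ * ((N i : ℝ) ^ ((σ - 1) / 2) * (N i : ℝ) ^ (-σ)) := by ring
      _ = ((σ - 1) / 2)⁻¹ * (N i : ℝ) ^ (-((σ + 1) / 2)) := by
          rw [← Real.rpow_add hpos]
          congr 2
          ring

theorem summable_norm_log_div_natCast_cpow (hN : ∀ i, 2 ≤ N i)
    (hsum : ∀ σ : ℝ, 1 < σ → Summable fun i => (N i : ℝ) ^ (-σ)) {s : ℂ} (hs : 1 < s.re) :
    Summable fun im : ι × ℕ =>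
      ‖(Real.log (N im.1) : ℂ) / (N im.1 : ℂ) ^ (s * (2 * im.2 + 1))‖ := by
  have hlog (i : ι) : 0 ≤ Real.log (N i) := Real.log_natCast_nonneg _
  refine Summable.of_nonneg_of_le (fun _ => norm_nonneg _) (fun im => ?_)
    ((summable_log_mul_rpow_neg hsum hs hN).mul_of_nonneg summable_geometric_two
      (fun i => mul_nonneg (hlog i) (by positivity)) (fun _ => by positivity))
  have h2 := two_le_norm_natCast_cpow (hN im.1) hs
  rw [natCast_cpow_odd_multiple (hN im.1), norm_div, norm_mul, norm_pow, norm_pow,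
    Complex.norm_real, Real.norm_of_nonneg (hlog _), div_mul_eq_div_div,
    Real.rpow_neg (Nat.cast_nonneg _),
    ← Complex.norm_natCast_cpow_of_pos (by have := hN im.1; omega), ← div_eq_mul_inv,
    div_eq_mul_inv _ ((‖_‖ ^ 2) ^ im.2), ← inv_pow, one_div]
  have := hlog im.1
  gcongr
  nlinarith

theorem multipliableLocallyUniformlyOn_natCast_cpow (hN : ∀ i, 2 ≤ N i)
    (hsum : ∀ σ : ℝ, 1 < σ → Summable fun i => (N i : ℝ) ^ (-σ)) {σ : ℝ} (hσ : 1 < σ) :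
    MultipliableLocallyUniformlyOn
      (fun i (s : ℂ) => ((N i : ℂ) ^ s + 1) / ((N i : ℂ) ^ s - 1)) {s : ℂ | σ < s.re} := by
  refine MultipliableLocallyUniformlyOn_congr
    (f := fun i (s : ℂ) => 1 + 2 / ((N i : ℂ) ^ s - 1)) (fun i s hs =>
      (natCast_cpow_add_one_div_sub_one (hN i) (hσ.trans hs)).symm) ?_
  refine Summable.multipliableLocallyUniformlyOn_one_add
    (isOpen_lt continuous_const Complex.continuous_re) ((hsum σ hσ).mul_left 4) (.of_forall fun i s hs => ?_) fun i s hs =>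
      (differentiableAt_two_div_natCast_cpow_sub_one (hN i)
        (hσ.trans hs)).continuousAt.continuousWithinAt
  refine (norm_two_div_natCast_cpow_sub_one_le (hN i) (hσ.trans hs)).trans ?_
  have hN1 : (1 : ℝ) ≤ N i := by exact_mod_cast one_le_two.trans (hN i)
  have hs' : σ < s.re := hs
  gcongr

theorem differentiableAt_tprod_natCast_cpow (hN : ∀ i, 2 ≤ N i)
    (hsum : ∀ σ : ℝ, 1 < σ → Summable fun i => (N i : ℝ) ^ (-σ)) {s : ℂ} (hs : 1 < s.re) :
    DifferentiableAt ℂ (fun z : ℂ => ∏' i, ((N i : ℂ) ^ z + 1) / ((N i : ℂ) ^ z - 1)) s := by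
  obtain ⟨σ, hσ, hσs⟩ := exists_between hs
  have hopen : IsOpen {z : ℂ | σ < z.re} := isOpen_lt continuous_const Complex.continuous_re
  refine (TendstoLocallyUniformlyOn.differentiableOn
    (multipliableLocallyUniformlyOn_natCast_cpow hN hsum hσ).hasProdLocallyUniformlyOn
    (.of_forall fun t => DifferentiableOn.fun_finsetProd fun i _ z hz => ?_)
    hopen).differentiableAt (hopen.mem_nhds hσs)
  exact (differentiableAt_natCast_cpow_add_one_div_sub_one (hN i)
    (hσ.trans hz)).differentiableWithinAt

theorem tprod_natCast_cpow_ne_zero (hN : ∀ i, 2 ≤ N i)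
    (hsum : ∀ σ : ℝ, 1 < σ → Summable fun i => (N i : ℝ) ^ (-σ)) {s : ℂ} (hs : 1 < s.re) :
    ∏' i, ((N i : ℂ) ^ s + 1) / ((N i : ℂ) ^ s - 1) ≠ 0 := by
  rw [tprod_congr fun i => natCast_cpow_add_one_div_sub_one (hN i) hs]
  refine tprod_one_add_ne_zero_of_summable (fun i => ?_)
    (((hsum s.re hs).mul_left 4).of_nonneg_of_le (fun _ => norm_nonneg _)
      fun i => norm_two_div_natCast_cpow_sub_one_le (hN i) hs)
  rw [← natCast_cpow_add_one_div_sub_one (hN i) hs]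
  exact natCast_cpow_add_one_div_sub_one_ne_zero (hN i) hs

theorem hasSum_logDeriv_natCast_cpow (hN : ∀ i, 2 ≤ N i)
    (hsum : ∀ σ : ℝ, 1 < σ → Summable fun i => (N i : ℝ) ^ (-σ)) {s : ℂ} (hs : 1 < s.re) :
    HasSum (fun i => logDeriv (fun z : ℂ => ((N i : ℂ) ^ z + 1) / ((N i : ℂ) ^ z - 1)) s)
      (-2 * ∑' im : ι × ℕ, (Real.log (N im.1) : ℂ) / (N im.1 : ℂ) ^ (s * (2 * im.2 + 1))) := by
  have hprod : Summable fun im : ι × ℕ =>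
      (Real.log (N im.1) : ℂ) / (N im.1 : ℂ) ^ (s * (2 * im.2 + 1)) :=
    (summable_norm_log_div_natCast_cpow hN hsum hs).of_norm
  have hfiber (i : ι) := hasSum_log_div_natCast_cpow (hN i) hs
  have hdouble := hprod.hasSum.prod_fiberwise hfiber
  exact (hdouble.mul_left (-2)).congr_fun fun i =>
    logDeriv_natCast_cpow_add_one_div_sub_one (hN i) hs

theorem logDeriv_tprod_natCast_cpow (hN : ∀ i, 2 ≤ N i)
    (hsum : ∀ σ : ℝ, 1 < σ → Summable fun i => (N i : ℝ) ^ (-σ)) {s : ℂ} (hs : 1 < s.re) :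
    logDeriv (fun z : ℂ => ∏' i, ((N i : ℂ) ^ z + 1) / ((N i : ℂ) ^ z - 1)) s =
      -2 * ∑' im : ι × ℕ, (Real.log (N im.1) : ℂ) / (N im.1 : ℂ) ^ (s * (2 * im.2 + 1)) := by
  obtain ⟨σ, hσ, hσs⟩ := exists_between hs
  have hopen : IsOpen {z : ℂ | σ < z.re} := isOpen_lt continuous_const Complex.continuous_re
  have hlog := hasSum_logDeriv_natCast_cpow hN hsum hs
  rw [← hlog.tsum_eq]
  refine logDeriv_tprod_eq_tsum hopen hσs
    (fun i => natCast_cpow_add_one_div_sub_one_ne_zero (hN i) hs) (fun i z hz => ?_)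
    hlog.summable (multipliableLocallyUniformlyOn_natCast_cpow hN hsum hσ)
    (tprod_natCast_cpow_ne_zero hN hsum hs)
  exact (differentiableAt_natCast_cpow_add_one_div_sub_one (hN i)
    (hσ.trans hz)).differentiableWithinAt

end EulerProduct

theorem two_le_absNorm_inertPrimes {F K : Type*} [Field F] [NumberField F] [Field K]
    [NumberField K] [Algebra F K] (𝔮 : InertPrimes F K) : 2 ≤ Ideal.absNorm 𝔮.1 := by
  have h0 : Ideal.absNorm 𝔮.1 ≠ 0 := fun h => 𝔮.2.2.1 (Ideal.absNorm_eq_zero_iff.mp h)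
  have h1 : Ideal.absNorm 𝔮.1 ≠ 1 := fun h => 𝔮.2.1.ne_top (Ideal.absNorm_eq_one_iff.mp h)
  omega

/-- for a degree-two extension `K/F` of number fields, the product defining
`U(s) = (s−1)·∏_{𝔮 inert} (N𝔮^s+1)/(N𝔮^s−1)` converges on `Re(s) > 1`, `U` is holomorphic
and nonvanishing there, and its logarithmic derivative is
`U'(s)/U(s) = 1/(s−1) − 2·∑_{𝔮 inert} ∑_{m ≥ 0} (log N𝔮)/N𝔮^{s(2m+1)}`, the double sum
converging absolutely for `Re(s) > 1`. -/
theorem stmt_16 (hdeg : Module.finrank F K = 2) :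
    (∀ s : ℂ, 1 < s.re →
      Multipliable (fun 𝔮 : InertPrimes F K =>
        (((Ideal.absNorm 𝔮.1 : ℂ) ^ s + 1) / ((Ideal.absNorm 𝔮.1 : ℂ) ^ s - 1)))) ∧
    DifferentiableOn ℂ (Ufun F K) {s : ℂ | 1 < s.re} ∧
    (∀ s : ℂ, 1 < s.re → Ufun F K s ≠ 0) ∧
    (∀ s : ℂ, 1 < s.re →
      Summable (fun qm : InertPrimes F K × ℕ =>
        ‖(Real.log (Ideal.absNorm qm.1.1) : ℂ) /
          (Ideal.absNorm qm.1.1 : ℂ) ^ (s * (2 * qm.2 + 1))‖) ∧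
      deriv (Ufun F K) s / Ufun F K s =
        1 / (s - 1) -
          2 * ∑' qm : InertPrimes F K × ℕ,
            (Real.log (Ideal.absNorm qm.1.1) : ℂ) /
              (Ideal.absNorm qm.1.1 : ℂ) ^ (s * (2 * qm.2 + 1))) := by
  have hN := two_le_absNorm_inertPrimes (F := F) (K := K)
  have hsum : ∀ σ : ℝ, 1 < σ →
      Summable fun 𝔮 : InertPrimes F K => (Ideal.absNorm 𝔮.1 : ℝ) ^ (-σ) := fun σ hσ =>
    (summable_absNorm_rpow_neg (F := F) hσ).comp_injective Subtype.val_injective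
  have hsub {s : ℂ} (hs : 1 < s.re) : s - 1 ≠ 0 := by
    intro h
    rw [sub_eq_zero.mp h, Complex.one_re] at hs
    exact lt_irrefl _ hs
  refine ⟨fun s hs => ?_, fun s hs => ?_, fun s hs => ?_, fun s hs => ⟨?_, ?_⟩⟩
  · obtain ⟨σ, hσ, hσs⟩ := exists_between hs
    exact (multipliableLocallyUniformlyOn_natCast_cpow hN hsum hσ).multipliable hσs
  · exact ((differentiableAt_fun_id.sub_const 1).mul
      (differentiableAt_tprod_natCast_cpow hN hsum hs)).differentiableWithinAt
  · exact mul_ne_zero (hsub hs) (tprod_natCast_cpow_ne_zero hN hsum hs)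
  · exact summable_norm_log_div_natCast_cpow hN hsum hs
  · have hmul := logDeriv_mul s (hsub hs) (tprod_natCast_cpow_ne_zero hN hsum hs)
      (differentiableAt_fun_id.sub_const 1) (differentiableAt_tprod_natCast_cpow hN hsum hs)
    rw [logDeriv_tprod_natCast_cpow hN hsum hs, logDeriv_apply (fun z : ℂ => z - 1)] at hmul
    change logDeriv (Ufun F K) s = _
    refine hmul.trans ?_
    rw [deriv_sub_const, deriv_id'']
    ring
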